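/- Let λ, λ' ∈ ℂ with λ+λ' ∉ ℤ. With ΔC := (q−q^{−1})² ΔF∘ΔE + q ΔK + q^{−1} ΔK^{−1} on ℂ[x,y], where ΔK^{−1}(x^k y^l) = q^{−λ−λ'−2k−2l} x^k y^l, one has for all n, k ∈ ℕ: ΔC(ΔE^k(P_n^{λ,λ'})) = (q^{λ+λ'+2n−1} + q^{−(λ+λ'+2n−1)}) ΔE^k(P_n^{λ,λ'}); i.e. the diagonal Casimir acts on the copy of V_{λ+λ'+2n} inside V_λ ⊗ V_{λ'} by the scalar q^{λ+λ'+2n−1} + q^{−(λ+λ'+2n−1)}. -/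

import Mathlib

noncomputable section

open Finset

def qnum (q x : ℂ) : ℂ := (q ^ x - q ^ (-x)) / (q - q⁻¹)

def qpoch (q x : ℂ) (n : ℕ) : ℂ := ∏ s ∈ Finset.range n, qnum q (x + s)

def qfact (q : ℂ) (n : ℕ) : ℂ := ∏ s ∈ Finset.range n, qnum q ((s : ℂ) + 1)

def qbinom (q : ℂ) (n k : ℕ) : ℂ := qfact q n / (qfact q k * qfact q (n - k))

abbrev P2 : Type := (ℕ × ℕ) →₀ ℂ

def mono (k l : ℕ) : P2 := Finsupp.single (k, l) 1

def ΔK (q lam lam' : ℂ) : P2 →ₗ[ℂ] P2 :=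
  Finsupp.lsum ℂ fun kl => LinearMap.toSpanSingleton ℂ P2
    ((q ^ (lam + lam' + 2 * (kl.1 : ℂ) + 2 * (kl.2 : ℂ))) • mono kl.1 kl.2)

def ΔE (q lam : ℂ) : P2 →ₗ[ℂ] P2 :=
  Finsupp.lsum ℂ fun kl => LinearMap.toSpanSingleton ℂ P2
    (mono (kl.1 + 1) kl.2 + (q ^ (lam + 2 * (kl.1 : ℂ))) • mono kl.1 (kl.2 + 1))

def ΔF (q lam lam' : ℂ) : P2 →ₗ[ℂ] P2 :=
  Finsupp.lsum ℂ fun kl => LinearMap.toSpanSingleton ℂ P2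
    ((-(q ^ (-lam' - 2 * (kl.2 : ℂ)) * qnum q (lam + (kl.1 : ℂ) - 1) * qnum q (kl.1 : ℂ))) • mono (kl.1 - 1) kl.2
      + (-(qnum q (lam' + (kl.2 : ℂ) - 1) * qnum q (kl.2 : ℂ))) • mono kl.1 (kl.2 - 1))

def Pvec (q lam lam' : ℂ) (n : ℕ) : P2 :=
  ∑ k ∈ Finset.range (n + 1),
    (qbinom q n k * (-1) ^ k * q ^ ((k : ℂ) * (lam' + 2 * (n : ℂ) - (k : ℂ) - 1))
      * qpoch q (lam + (k : ℂ)) (n - k) * qpoch q (lam' + ((n - k : ℕ) : ℂ)) k) • mono k (n - k)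

/-- ΔK⁻¹(x^k y^l) = q^{−λ−λ'−2k−2l} x^k y^l. -/
def ΔKinv (q lam lam' : ℂ) : P2 →ₗ[ℂ] P2 :=
  Finsupp.lsum ℂ fun kl => LinearMap.toSpanSingleton ℂ P2
    ((q ^ (-lam - lam' - 2 * (kl.1 : ℂ) - 2 * (kl.2 : ℂ))) • mono kl.1 kl.2)

/-- The diagonal Casimir operator ΔC = (q−q⁻¹)² ΔF∘ΔE + q ΔK + q⁻¹ ΔK⁻¹. -/
def ΔC (q lam lam' : ℂ) : P2 →ₗ[ℂ] P2 :=
  ((q - q⁻¹) ^ 2) • (ΔF q lam lam' ∘ₗ ΔE q lam)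
    + q • ΔK q lam lam' + q⁻¹ • ΔKinv q lam lam'

theorem ΔE_mono (q lam : ℂ) (k l : ℕ) :
    ΔE q lam (mono k l) = mono (k + 1) l + (q ^ (lam + 2 * (k : ℂ))) • mono k (l + 1) := by
  simp [ΔE, mono]

theorem ΔF_mono (q lam lam' : ℂ) (k l : ℕ) :
    ΔF q lam lam' (mono k l) =
      (-(q ^ (-lam' - 2 * (l : ℂ)) * qnum q (lam + (k : ℂ) - 1) * qnum q (k : ℂ))) •
          mono (k - 1) l
        + (-(qnum q (lam' + (l : ℂ) - 1) * qnum q (l : ℂ))) • mono k (l - 1) := by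
  rw [ΔF, mono, Finsupp.lsum_single, LinearMap.toSpanSingleton_apply, one_smul]

theorem ΔK_mono (q lam lam' : ℂ) (k l : ℕ) :
    ΔK q lam lam' (mono k l) =
      (q ^ (lam + lam' + 2 * (k : ℂ) + 2 * (l : ℂ))) • mono k l := by
  rw [ΔK, mono, Finsupp.lsum_single, LinearMap.toSpanSingleton_apply, one_smul]
  rfl

theorem ΔKinv_mono (q lam lam' : ℂ) (k l : ℕ) :
    ΔKinv q lam lam' (mono k l) =
      (q ^ (-lam - lam' - 2 * (k : ℂ) - 2 * (l : ℂ))) • mono k l := by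
  rw [ΔKinv, mono, Finsupp.lsum_single, LinearMap.toSpanSingleton_apply, one_smul]
  rfl

theorem linearMap_ext_mono {f g : P2 →ₗ[ℂ] P2} (h : ∀ k l, f (mono k l) = g (mono k l)) :
    f = g :=
  Finsupp.lhom_ext' fun kl => LinearMap.ext_ring (h kl.1 kl.2)

theorem cpow_two_mul (q x : ℂ) : q ^ (2 * x) = (q ^ x) ^ 2 := Complex.cpow_ofNat_mul q 2 x

theorem qnum_zero (q : ℂ) : qnum q 0 = 0 := by simp [qnum]

theorem qnum_smul_mono_pred_left (q : ℂ) (k l : ℕ) :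
    qnum q k • mono (k - 1 + 1) l = qnum q k • mono k l := by
  cases k <;> simp [qnum_zero]

theorem qnum_smul_mono_pred_right (q : ℂ) (k l : ℕ) :
    qnum q l • mono k (l - 1 + 1) = qnum q l • mono k l := by
  cases l <;> simp [qnum_zero]

theorem qnum_mul_cpow_pred (q lam : ℂ) (k : ℕ) :
    qnum q k * q ^ (lam + 2 * ((k - 1 : ℕ) : ℂ)) = qnum q k * q ^ (lam + 2 * (k : ℂ) - 2) := by
  cases k with
  | zero => simp [qnum_zero]
  | succ k =>
    simp only [Nat.add_sub_cancel, Nat.cast_succ]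
    ring_nf

theorem ΔK_comp_ΔE (q lam lam' : ℂ) (hq0 : q ≠ 0) :
    ΔK q lam lam' ∘ₗ ΔE q lam = q ^ 2 • (ΔE q lam ∘ₗ ΔK q lam lam') := by
  refine linearMap_ext_mono fun k l => ?_
  have h1 : q ^ (lam + lam' + 2 * ((k + 1 : ℕ) : ℂ) + 2 * (l : ℂ)) =
      q ^ 2 * q ^ (lam + lam' + 2 * (k : ℂ) + 2 * (l : ℂ)) := by
    rw [← Complex.cpow_ofNat q 2, ← Complex.cpow_add _ _ hq0]
    push_cast; ring_nf
  have h2 : q ^ (lam + lam' + 2 * (k : ℂ) + 2 * ((l + 1 : ℕ) : ℂ)) =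
      q ^ 2 * q ^ (lam + lam' + 2 * (k : ℂ) + 2 * (l : ℂ)) := by
    rw [← Complex.cpow_ofNat q 2, ← Complex.cpow_add _ _ hq0]
    push_cast; ring_nf
  simp only [LinearMap.comp_apply, LinearMap.smul_apply, ΔE_mono, ΔK_mono, map_add, map_smul,
    h1, h2]
  module

theorem ΔKinv_comp_ΔE (q lam lam' : ℂ) (hq0 : q ≠ 0) :
    ΔKinv q lam lam' ∘ₗ ΔE q lam = (q⁻¹) ^ 2 • (ΔE q lam ∘ₗ ΔKinv q lam lam') := by
  refine linearMap_ext_mono fun k l => ?_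
  have h1 : q ^ (-lam - lam' - 2 * ((k + 1 : ℕ) : ℂ) - 2 * (l : ℂ)) =
      (q⁻¹) ^ 2 * q ^ (-lam - lam' - 2 * (k : ℂ) - 2 * (l : ℂ)) := by
    rw [inv_pow, ← Complex.cpow_ofNat q 2, ← Complex.cpow_neg, ← Complex.cpow_add _ _ hq0]
    push_cast; ring_nf
  have h2 : q ^ (-lam - lam' - 2 * (k : ℂ) - 2 * ((l + 1 : ℕ) : ℂ)) =
      (q⁻¹) ^ 2 * q ^ (-lam - lam' - 2 * (k : ℂ) - 2 * (l : ℂ)) := by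
    rw [inv_pow, ← Complex.cpow_ofNat q 2, ← Complex.cpow_neg, ← Complex.cpow_add _ _ hq0]
    push_cast; ring_nf
  simp only [LinearMap.comp_apply, LinearMap.smul_apply, ΔE_mono, ΔKinv_mono, map_add, map_smul,
    h1, h2]
  module

theorem ΔE_ΔF_commutator (q lam lam' : ℂ) (hq0 : q ≠ 0) (hD : q - q⁻¹ ≠ 0) :
    (q - q⁻¹) • (ΔE q lam ∘ₗ ΔF q lam lam') =
      (q - q⁻¹) • (ΔF q lam lam' ∘ₗ ΔE q lam) + (ΔK q lam lam' - ΔKinv q lam lam') := by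
  refine linearMap_ext_mono fun k l => ?_
  simp only [LinearMap.comp_apply, LinearMap.smul_apply, LinearMap.add_apply,
    LinearMap.sub_apply, ΔE_mono, ΔF_mono, ΔK_mono, ΔKinv_mono, map_add, map_smul,
    Nat.add_sub_cancel]
  have hk := qnum_smul_mono_pred_left q k l
  have hl := qnum_smul_mono_pred_right q k l
  have hp := qnum_mul_cpow_pred q lam k
  have ha : q ^ lam ≠ 0 := by simp [Complex.cpow_eq_zero_iff, hq0]
  have hb : q ^ lam' ≠ 0 := by simp [Complex.cpow_eq_zero_iff, hq0]
  have hx : q ^ (k : ℂ) ≠ 0 := by simp [hq0]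
  have hy : q ^ (l : ℂ) ≠ 0 := by simp [hq0]
  have cross : q ^ (-lam' - 2 * (l : ℂ)) * q ^ (lam + 2 * (k : ℂ) - 2) =
      q ^ (lam + 2 * (k : ℂ)) * q ^ (-lam' - 2 * ((l + 1 : ℕ) : ℂ)) := by
    rw [← Complex.cpow_add _ _ hq0, ← Complex.cpow_add _ _ hq0]
    push_cast; ring_nf
  have diag : (q - q⁻¹) * (-(q ^ (-lam' - 2 * (l : ℂ)) * qnum q (lam + k - 1) * qnum q k)
        - q ^ (lam + 2 * (k : ℂ)) * (qnum q (lam' + l - 1) * qnum q l)) =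
      (q - q⁻¹) * (-(q ^ (-lam' - 2 * (l : ℂ)) * qnum q (lam + (k + 1 : ℕ) - 1) *
        qnum q (k + 1 : ℕ))
        - q ^ (lam + 2 * (k : ℂ)) * (qnum q (lam' + (l + 1 : ℕ) - 1) * qnum q (l + 1 : ℕ)))
      + (q ^ (lam + lam' + 2 * (k : ℂ) + 2 * (l : ℂ))
        - q ^ (-lam - lam' - 2 * (k : ℂ) - 2 * (l : ℂ))) := by
    have hD' : q ^ 2 - 1 ≠ 0 := by
      intro h
      apply hD
      field_simp
      simpa using h
    simp only [qnum, Nat.cast_succ, Complex.cpow_add _ _ hq0, Complex.cpow_sub _ _ hq0,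
      Complex.cpow_neg, cpow_two_mul, Complex.cpow_one]
    generalize q ^ lam = a at *
    generalize q ^ lam' = b at *
    generalize q ^ (k : ℂ) = x at *
    generalize q ^ (l : ℂ) = y at *
    field_simp
    ring
  linear_combination (norm := module)
    (-(q - q⁻¹) * q ^ (-lam' - 2 * (l : ℂ)) * qnum q (lam + k - 1)) • hk
    + (-(q - q⁻¹) * q ^ (lam + 2 * (k : ℂ)) * qnum q (lam' + l - 1)) • hl
    + diag • mono k l
    + (-(q - q⁻¹) * q ^ (-lam' - 2 * (l : ℂ)) * qnum q (lam + k - 1)) •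
        (hp • mono (k - 1) (l + 1))
    + (-(q - q⁻¹) * qnum q (lam + k - 1) * qnum q k) • (cross • mono (k - 1) (l + 1))

theorem ΔC_comp_ΔE (q lam lam' : ℂ) (hq0 : q ≠ 0) (hD : q - q⁻¹ ≠ 0) (v : P2) :
    ΔC q lam lam' (ΔE q lam v) = ΔE q lam (ΔC q lam lam' v) := by
  have h1 := LinearMap.congr_fun (ΔE_ΔF_commutator q lam lam' hq0 hD) (ΔE q lam v)
  have h2 := LinearMap.congr_fun (ΔK_comp_ΔE q lam lam' hq0) v
  have h3 := LinearMap.congr_fun (ΔKinv_comp_ΔE q lam lam' hq0) v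
  simp only [LinearMap.comp_apply, LinearMap.smul_apply, LinearMap.add_apply,
    LinearMap.sub_apply] at h1 h2 h3
  simp only [ΔC, LinearMap.comp_apply, LinearMap.smul_apply, LinearMap.add_apply, map_add,
    map_smul]
  rw [h2, h3] at h1 ⊢
  have e1 : q * q⁻¹ = 1 := mul_inv_cancel₀ hq0
  have c1 : (q - q⁻¹) * q ^ 2 = q ^ 3 - q := by linear_combination (-q) * e1
  have c2 : (q - q⁻¹) * q⁻¹ ^ 2 = q⁻¹ - q⁻¹ ^ 3 := by linear_combination q⁻¹ * e1
  linear_combination (norm := module) (-(q - q⁻¹)) • h1 + (-c1) • ΔE q lam (ΔK q lam lam' v)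
    + c2 • ΔE q lam (ΔKinv q lam lam' v)

theorem qnum_succ_ne_zero (q : ℂ) (hq0 : q ≠ 0) (hq : ∀ m : ℕ, 0 < m → q ^ m ≠ 1)
    (hD : q - q⁻¹ ≠ 0) (s : ℕ) : qnum q ((s : ℂ) + 1) ≠ 0 := by
  have hs : q ^ (s + 1) ≠ 0 := pow_ne_zero _ hq0
  refine div_ne_zero (fun h => hq (2 * (s + 1)) (by lia) ?_) hD
  rw [← Nat.cast_succ, Complex.cpow_neg, Complex.cpow_natCast, sub_eq_zero] at h
  rw [two_mul, pow_add]
  nth_rewrite 1 [h]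
  exact inv_mul_cancel₀ hs

theorem qfact_ne_zero (q : ℂ) (hq0 : q ≠ 0) (hq : ∀ m : ℕ, 0 < m → q ^ m ≠ 1)
    (hD : q - q⁻¹ ≠ 0) (n : ℕ) : qfact q n ≠ 0 :=
  Finset.prod_ne_zero_iff.2 fun s _ => qnum_succ_ne_zero q hq0 hq hD s

theorem qfact_succ (q : ℂ) (n : ℕ) : qfact q (n + 1) = qfact q n * qnum q ((n : ℂ) + 1) :=
  Finset.prod_range_succ _ _

theorem qpoch_succ (q x : ℂ) (n : ℕ) : qpoch q x (n + 1) = qnum q x * qpoch q (x + 1) n := by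
  simp only [qpoch, Finset.prod_range_succ']
  rw [mul_comm]
  congr 1
  · simp
  · exact Finset.prod_congr rfl fun s _ => by push_cast; ring_nf

theorem qbinom_succ_mul (q : ℂ) (hq0 : q ≠ 0) (hq : ∀ m : ℕ, 0 < m → q ^ m ≠ 1)
    (hD : q - q⁻¹ ≠ 0) (k m : ℕ) :
    qbinom q (k + m + 1) (k + 1) * qnum q ((k : ℂ) + 1) =
      qbinom q (k + m + 1) k * qnum q ((m : ℂ) + 1) := by
  have h1 : k + m + 1 - (k + 1) = m := by lia
  have h2 : k + m + 1 - k = m + 1 := by lia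
  have := qfact_ne_zero q hq0 hq hD k
  have := qfact_ne_zero q hq0 hq hD m
  have := qnum_succ_ne_zero q hq0 hq hD k
  have := qnum_succ_ne_zero q hq0 hq hD m
  rw [qbinom, qbinom, h1, h2, qfact_succ q k, qfact_succ q m]
  field_simp

/-- The coefficient of `mono k (n - k)` in `Pvec q lam lam' n`. -/
def pcoeff (q lam lam' : ℂ) (n k : ℕ) : ℂ :=
  qbinom q n k * (-1) ^ k * q ^ ((k : ℂ) * (lam' + 2 * (n : ℂ) - (k : ℂ) - 1))
    * qpoch q (lam + (k : ℂ)) (n - k) * qpoch q (lam' + ((n - k : ℕ) : ℂ)) k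

theorem pcoeff_succ (q lam lam' : ℂ) (hq0 : q ≠ 0) (hq : ∀ m : ℕ, 0 < m → q ^ m ≠ 1)
    (hD : q - q⁻¹ ≠ 0) (k m : ℕ) :
    pcoeff q lam lam' (k + m + 1) (k + 1) *
        (q ^ (-lam' - 2 * (m : ℂ)) * qnum q (lam + k) * qnum q ((k : ℂ) + 1)) =
      -(pcoeff q lam lam' (k + m + 1) k * (qnum q (lam' + m) * qnum q ((m : ℂ) + 1))) := by
  have h1 : k + m + 1 - (k + 1) = m := by lia
  have h2 : k + m + 1 - k = m + 1 := by lia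
  have hc : q ^ (((k + 1 : ℕ) : ℂ) * (lam' + 2 * ((k + m + 1 : ℕ) : ℂ) - ((k + 1 : ℕ) : ℂ) - 1))
      * q ^ (-lam' - 2 * (m : ℂ)) =
      q ^ ((k : ℂ) * (lam' + 2 * ((k + m + 1 : ℕ) : ℂ) - (k : ℂ) - 1)) := by
    rw [← Complex.cpow_add _ _ hq0]
    push_cast; ring_nf
  have hb := qbinom_succ_mul q hq0 hq hD k m
  rw [pcoeff, pcoeff, h1, h2, qpoch_succ, qpoch_succ, ← hc]
  have e1 : lam + ((k + 1 : ℕ) : ℂ) = lam + k + 1 := by push_cast; ring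
  have e2 : lam' + ((m + 1 : ℕ) : ℂ) = lam' + m + 1 := by push_cast; ring
  rw [e1, e2, pow_succ]
  generalize q ^ (((k + 1 : ℕ) : ℂ) * _) = A
  linear_combination (-(-1) ^ k * A * q ^ (-lam' - 2 * (m : ℂ)) * qnum q (lam + k) *
    qpoch q (lam + k + 1) m * qnum q (lam' + m) * qpoch q (lam' + m + 1) k) * hb

theorem ΔF_Pvec (q lam lam' : ℂ) (hq0 : q ≠ 0) (hq : ∀ m : ℕ, 0 < m → q ^ m ≠ 1)
    (hD : q - q⁻¹ ≠ 0) (n : ℕ) : ΔF q lam lam' (Pvec q lam lam' n) = 0 := by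
  change ΔF q lam lam' (∑ k ∈ Finset.range (n + 1), pcoeff q lam lam' n k • mono k (n - k)) = 0
  simp only [map_sum, map_smul, ΔF_mono, smul_add, Finset.sum_add_distrib]
  rw [Finset.sum_range_succ', Finset.sum_range_succ (fun k => _ • _ • mono k (n - k - 1))]
  simp only [Nat.cast_zero, qnum_zero, Nat.sub_self, mul_zero, neg_zero, zero_smul, smul_zero,
    add_zero]
  rw [← Finset.sum_add_distrib]
  refine Finset.sum_eq_zero fun k hk => ?_
  obtain ⟨m, rfl⟩ : ∃ m, n = k + m + 1 :=
    ⟨n - k - 1, by have := Finset.mem_range.1 hk; lia⟩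
  have h1 : k + m + 1 - (k + 1) = m := by lia
  have h2 : k + m + 1 - k = m + 1 := by lia
  have h := pcoeff_succ q lam lam' hq0 hq hD k m
  have e1 : lam + ((k + 1 : ℕ) : ℂ) - 1 = lam + k := by push_cast; ring
  have e2 : lam' + ((m + 1 : ℕ) : ℂ) - 1 = lam' + m := by push_cast; ring
  rw [h1, h2, e1, e2, Nat.add_sub_cancel, Nat.add_sub_cancel, Nat.cast_succ, Nat.cast_succ]
  linear_combination (norm := module) (-h) • mono k m

theorem ΔK_Pvec (q lam lam' : ℂ) (n : ℕ) :
    ΔK q lam lam' (Pvec q lam lam' n) = q ^ (lam + lam' + 2 * (n : ℂ)) • Pvec q lam lam' n := by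
  simp only [Pvec, map_sum, map_smul, ΔK_mono, Finset.smul_sum]
  refine Finset.sum_congr rfl fun k hk => ?_
  rw [Nat.cast_sub (Finset.mem_range_succ_iff.1 hk), smul_comm]
  ring_nf

theorem ΔKinv_Pvec (q lam lam' : ℂ) (n : ℕ) :
    ΔKinv q lam lam' (Pvec q lam lam' n) =
      q ^ (-(lam + lam' + 2 * (n : ℂ))) • Pvec q lam lam' n := by
  simp only [Pvec, map_sum, map_smul, ΔKinv_mono, Finset.smul_sum]
  refine Finset.sum_congr rfl fun k hk => ?_
  rw [Nat.cast_sub (Finset.mem_range_succ_iff.1 hk), smul_comm]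
  ring_nf

theorem ΔC_Pvec (q lam lam' : ℂ) (hq0 : q ≠ 0) (hq : ∀ m : ℕ, 0 < m → q ^ m ≠ 1)
    (hD : q - q⁻¹ ≠ 0) (n : ℕ) :
    ΔC q lam lam' (Pvec q lam lam' n) =
      (q ^ (lam + lam' + 2 * (n : ℂ) - 1) + q ^ (-(lam + lam' + 2 * (n : ℂ) - 1))) •
        Pvec q lam lam' n := by
  have h := LinearMap.congr_fun (ΔE_ΔF_commutator q lam lam' hq0 hD) (Pvec q lam lam' n)
  simp only [LinearMap.comp_apply, LinearMap.smul_apply, LinearMap.add_apply,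
    LinearMap.sub_apply, ΔF_Pvec q lam lam' hq0 hq hD, ΔK_Pvec, ΔKinv_Pvec, map_zero,
    smul_zero] at h
  simp only [ΔC, LinearMap.comp_apply, LinearMap.smul_apply, LinearMap.add_apply, ΔK_Pvec,
    ΔKinv_Pvec]
  have e1 : q ^ (lam + lam' + 2 * (n : ℂ) - 1) = q⁻¹ * q ^ (lam + lam' + 2 * (n : ℂ)) := by
    rw [Complex.cpow_sub _ _ hq0, Complex.cpow_one, div_eq_inv_mul]
  have e2 : q ^ (-(lam + lam' + 2 * (n : ℂ) - 1)) = q * q ^ (-(lam + lam' + 2 * (n : ℂ))) := by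
    rw [neg_sub, sub_eq_add_neg, Complex.cpow_add _ _ hq0, Complex.cpow_one]
  rw [e1, e2]
  linear_combination (norm := module) (-(q - q⁻¹)) • h

/-- **Eigenvalue of the diagonal Casimir on each summand** (after Cor. 3.9).
On the copy of V_{λ+λ'+2n} spanned by the vectors ΔE^k(P_n^{λ,λ'}), the diagonal
Casimir acts by the scalar q^{λ+λ'+2n−1} + q^{−(λ+λ'+2n−1)}. -/
theorem casimir_eigenvalue_on_summand (q : ℂ) (hq0 : q ≠ 0)
    (hq : ∀ m : ℕ, 0 < m → q ^ m ≠ 1)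
    (lam lam' : ℂ) (hll : ∀ m : ℤ, lam + lam' ≠ (m : ℂ)) (n k : ℕ) :
    ΔC q lam lam' (((ΔE q lam) ^ k) (Pvec q lam lam' n))
      = (q ^ (lam + lam' + 2 * (n : ℂ) - 1) + q ^ (-(lam + lam' + 2 * (n : ℂ) - 1))) •
          ((ΔE q lam) ^ k) (Pvec q lam lam' n) := by
  have hD : q - q⁻¹ ≠ 0 := fun h => hq 2 two_pos <| by
    rw [pow_two]
    nth_rewrite 2 [sub_eq_zero.1 h]
    exact mul_inv_cancel₀ hq0
  induction k with
  | zero => exact ΔC_Pvec q lam lam' hq0 hq hD n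
  | succ k ih =>
    rw [pow_succ', Module.End.mul_apply, ΔC_comp_ΔE q lam lam' hq0 hD, ih, map_smul]
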